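/- Let g be C^1, even, with g' strictly increasing, odd, unbounded (density in volume coordinates for Borell density e^{x²}). Let λ(V₁) be the tie function. Then for the Borell density f(x)=e^{x²}, for every ε>0 and all sufficiently large V₁: V₁·(log V₁)^{1/2−ε} ≤ λ(V₁) ≤ V₁^{4+ε}. -/

import Mathlib

open Filter

/-- The volume `∫₀ˣ exp (t²) dt` of the interval `[0, x]` for the Borell density. -/
noncomputable def borellVol (x : ℝ) : ℝ := ∫ t in (0:ℝ)..x, Real.exp (t ^ 2)

namespace borellVol

open Real

theorem hasDerivAt (x : ℝ) : HasDerivAt borellVol (exp (x ^ 2)) x := by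
  have hc : Continuous fun t : ℝ => exp (t ^ 2) := by fun_prop
  exact intervalIntegral.integral_hasDerivAt_right (hc.intervalIntegrable _ _)
    (hc.stronglyMeasurableAtFilter _ _) hc.continuousAt

theorem hasDerivAt_exp_sq (x : ℝ) :
    HasDerivAt (fun y : ℝ => exp (y ^ 2)) (2 * x * exp (x ^ 2)) x := by
  convert (hasDerivAt_pow 2 x).exp using 1
  norm_num
  ring

theorem strictMono : StrictMono borellVol :=
  strictMono_of_hasDerivAt_pos hasDerivAt fun _ => exp_pos _

@[simp] theorem map_zero : borellVol 0 = 0 := by simp [borellVol]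

theorem map_neg (x : ℝ) : borellVol (-x) = -borellVol x := by
  have h := intervalIntegral.integral_comp_neg (a := 0) (b := x) fun t : ℝ => exp (t ^ 2)
  simp only [neg_sq, neg_zero] at h
  rw [borellVol, borellVol, intervalIntegral.integral_symm, ← h]

theorem nonneg {x : ℝ} (hx : 0 ≤ x) : 0 ≤ borellVol x := by
  simpa using strictMono.monotone hx

/-- In volume coordinates the density is convex: it lies above its tangent lines. -/
theorem tangent_le (x y : ℝ) :
    exp (x ^ 2) + 2 * x * (borellVol y - borellVol x) ≤ exp (y ^ 2) := by
  have hd : ∀ t, HasDerivAt (fun t => exp (t ^ 2) - 2 * x * borellVol t)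
      (2 * (t - x) * exp (t ^ 2)) t := fun t => 
    ((hasDerivAt_exp_sq t).sub ((hasDerivAt t).const_mul (2 * x))).congr_deriv (by ring)
  have hcont : Continuous fun t => exp (t ^ 2) - 2 * x * borellVol t :=
    continuous_iff_continuousAt.2 fun t => (hd t).continuousAt
  rcases le_total x y with hxy | hxy
  · have hm := monotoneOn_of_hasDerivWithinAt_nonneg (convex_Ici x) hcont.continuousOn
      (fun t _ => (hd t).hasDerivWithinAt) fun t ht => by
        rw [interior_Ici, Set.mem_Ioi] at ht
        exact mul_nonneg (by linarith) (exp_pos _).le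
    have := hm Set.self_mem_Ici hxy hxy
    simp only at this
    linarith
  · have hm := antitoneOn_of_hasDerivWithinAt_nonpos (convex_Iic x) hcont.continuousOn
      (fun t _ => (hd t).hasDerivWithinAt) fun t ht => by
        rw [interior_Iic, Set.mem_Iio] at ht
        exact mul_nonpos_of_nonpos_of_nonneg (by linarith) (exp_pos _).le
    have := hm hxy Set.self_mem_Iic hxy
    simp only at this
    linarith

theorem mul_exp_le_sub {a b : ℝ} (ha : 0 ≤ a) (hab : a ≤ b) :
    (b - a) * exp (a ^ 2) ≤ borellVol b - borellVol a := by
  rcases hab.eq_or_lt with rfl | hlt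
  · simp
  obtain ⟨c, hc, h⟩ := exists_hasDerivAt_eq_slope borellVol (fun t => exp (t ^ 2)) hlt
    (fun t _ => (hasDerivAt t).continuousAt.continuousWithinAt) fun t _ => hasDerivAt t
  rw [eq_div_iff (by linarith)] at h
  rw [← h, mul_comm]
  have := hc.1.le
  have : 0 ≤ b - a := by linarith
  gcongr

theorem sub_le_mul_exp {a b : ℝ} (ha : 0 ≤ a) (hab : a ≤ b) :
    borellVol b - borellVol a ≤ (b - a) * exp (b ^ 2) := by
  rcases hab.eq_or_lt with rfl | hlt
  · simp
  obtain ⟨c, hc, h⟩ := exists_hasDerivAt_eq_slope borellVol (fun t => exp (t ^ 2)) hlt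
    (fun t _ => (hasDerivAt t).continuousAt.continuousWithinAt) fun t _ => hasDerivAt t
  rw [eq_div_iff (by linarith)] at h
  rw [← h, mul_comm]
  have := hc.2.le
  have : 0 ≤ c := by linarith [hc.1]
  have : 0 ≤ b - a := by linarith
  gcongr

theorem le_exp_sq (x : ℝ) : borellVol x ≤ exp (x ^ 2) := by
  have h₁ := tangent_le (1 / 2) x
  have h₂ := sub_le_mul_exp (a := 0) (b := 1 / 2) le_rfl (by norm_num)
  rw [map_zero] at h₂
  have := exp_pos ((1 / 2 : ℝ) ^ 2)
  linarith

theorem two_mul_le_map_add_one {x : ℝ} (hx : 0 ≤ x) : 2 * borellVol x ≤ borellVol (x + 1) := by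
  have h := mul_exp_le_sub hx (by linarith : x ≤ x + 1)
  have := le_exp_sq x
  linarith

theorem two_mul_mul_le {x : ℝ} (hx : 0 ≤ x) :
    2 * x * borellVol x ≤ exp (x ^ 2) - 1 + 2 * borellVol x := by
  have hd : ∀ t, HasDerivAt (fun t => exp (t ^ 2) + 2 * borellVol t - 2 * t * borellVol t)
      (2 * (exp (t ^ 2) - borellVol t)) t := fun t => 
    (((hasDerivAt_exp_sq t).add ((hasDerivAt t).const_mul 2)).sub
      (((hasDerivAt_id' t).const_mul 2).mul (hasDerivAt t))).congr_deriv (by ring)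
  have hm := monotone_of_hasDerivAt_nonneg hd fun t => by
    have := le_exp_sq t
    simp only [Pi.zero_apply]
    linarith
  have := hm hx
  simp only [map_zero] at this
  norm_num at this
  linarith

theorem exp_sq_le_two_mul_exp_sq {a b : ℝ} (ha : 0 ≤ a) (h : borellVol b = 2 * borellVol a) :
    exp (b ^ 2) + 1 ≤ 2 * exp (a ^ 2) + 4 * borellVol a := by
  have h₁ := tangent_le b a
  have h₂ := two_mul_mul_le ha
  have hb : b ≤ a + 1 := strictMono.le_iff_le.1 (h ▸ two_mul_le_map_add_one ha)
  have h₃ := mul_le_mul_of_nonneg_right hb (nonneg ha)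
  rw [h] at h₁
  linarith

theorem exp_sub_two_sq_le {z : ℝ} (hz : 2 ≤ z) :
    2 * exp ((z - 2) ^ 2) - 1 ≤ 2 * z * borellVol z - exp (z ^ 2) := by
  have h₁ := tangent_le z (z - 1)
  have h₂ := tangent_le (z - 1) 0
  have h₃ := mul_exp_le_sub (a := z - 2) (b := z - 1) (by linarith) (by linarith)
  have h₄ := nonneg (x := z - 2) (by linarith)
  norm_num at h₂
  linarith

theorem exp_growth {z : ℝ} (hz : 10 ≤ z) :
    3 + 8 * z * exp (z ^ 2 / 4) + 4 * exp (((z + 1) / 2) ^ 2) < 2 * exp ((z - 2) ^ 2) := by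
  have h8 : (8:ℝ) ≤ exp z := by linarith [add_one_le_exp z]
  have hz' : z ≤ exp z := by linarith [add_one_le_exp z]
  have h₁ : 3 ≤ exp (z ^ 2 / 4 + 3 * z) := by
    have := add_one_le_exp (z ^ 2 / 4 + 3 * z)
    nlinarith
  have h₂ : 8 * z * exp (z ^ 2 / 4) ≤ exp (z ^ 2 / 4 + 3 * z) := by
    calc 8 * z * exp (z ^ 2 / 4) ≤ exp z * exp z * exp (z ^ 2 / 4) := by gcongr
      _ = exp (z ^ 2 / 4 + 2 * z) := by rw [← exp_add, ← exp_add]; ring_nf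
      _ ≤ _ := exp_le_exp.2 (by linarith)
  have h₃ : 4 * exp (((z + 1) / 2) ^ 2) ≤ exp (z ^ 2 / 4 + 3 * z) := by
    calc 4 * exp (((z + 1) / 2) ^ 2) ≤ exp z * exp (((z + 1) / 2) ^ 2) := by
          gcongr; linarith
      _ = exp (z + ((z + 1) / 2) ^ 2) := by rw [← exp_add]
      _ ≤ _ := exp_le_exp.2 (by nlinarith)
  have h₄ : 3 * exp (z ^ 2 / 4 + 3 * z) ≤ exp ((z - 2) ^ 2) := by
    calc 3 * exp (z ^ 2 / 4 + 3 * z) ≤ exp 2 * exp (z ^ 2 / 4 + 3 * z) := by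
          gcongr; linarith [add_one_le_exp (2:ℝ)]
      _ = exp (2 + (z ^ 2 / 4 + 3 * z)) := by rw [← exp_add]
      _ ≤ _ := exp_le_exp.2 (by nlinarith)
  have := exp_pos ((z - 2) ^ 2)
  linarith

/-- If the second volume is at least the fourth power of the first one, every triple interval
has larger perimeter than the double interval. -/
theorem double_lt_triple {v u z y p q r : ℝ} (hv : 1 ≤ v) (hu : 2 * borellVol u = v)
    (hz : 2 * borellVol z = v + borellVol y) (hpq : borellVol q - borellVol p = v)
    (hqr : borellVol r - borellVol q = borellVol y) (hvy : v ^ 4 ≤ borellVol y)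
    (hz10 : 10 ≤ z) :
    2 * (exp (u ^ 2) + exp (z ^ 2)) < exp (p ^ 2) + exp (q ^ 2) + exp (r ^ 2) := by
  have hvv : v ≤ v ^ 4 := le_self_pow₀ hv (by norm_num)
  have hzy : z ≤ y := strictMono.le_iff_le.1 (by linarith)
  have huz : u ≤ z := strictMono.le_iff_le.1 (by linarith)
  have hyz : y ≤ z + 1 := strictMono.le_iff_le.1 (by
    linarith [two_mul_le_map_add_one (x := z) (by linarith)])
  have tp := tangent_le (-(y / 2)) p
  have tq := tangent_le (-(y / 2)) q
  have tr := tangent_le y r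
  rw [map_neg, neg_sq] at tp tq
  have triple_ge : exp (y ^ 2) + y * v + 2 * (exp ((y / 2) ^ 2) - y * borellVol (y / 2)) ≤
      exp (p ^ 2) + exp (q ^ 2) + exp (r ^ 2) := by
    have e₁ : borellVol p = borellVol q - v := by linarith
    have e₂ : borellVol r = borellVol y + borellVol q := by linarith
    rw [e₁] at tp
    rw [e₂] at tr
    linarith
  have half_le : y * borellVol (y / 2) ≤ exp ((y / 2) ^ 2) + 2 * exp (((z + 1) / 2) ^ 2) := by
    have h₁ := two_mul_mul_le (x := y / 2) (by linarith)
    have h₂ := le_exp_sq (y / 2)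
    have h₃ : exp ((y / 2) ^ 2) ≤ exp (((z + 1) / 2) ^ 2) := by
      have : 0 ≤ y / 2 := by linarith
      gcongr
    linarith
  have large_ge := tangent_le z y
  have small_le : 2 * exp (u ^ 2) ≤ 2 + 2 * z * v := by
    have h₁ := tangent_le u 0
    have h₂ := mul_le_mul_of_nonneg_right huz (by linarith : 0 ≤ v)
    rw [map_zero, zero_pow two_ne_zero, exp_zero] at h₁
    have e : 2 * u * (0 - borellVol u) = -(u * v) := by rw [← hu]; ring
    linarith
  have v_le : v ≤ 2 * exp (z ^ 2 / 4) := by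
    refine le_of_pow_le_pow_left₀ (n := 4) (by norm_num) (by positivity) ?_
    have e : (2 * exp (z ^ 2 / 4)) ^ 4 = 16 * exp (z ^ 2) := by
      rw [mul_pow, ← exp_nat_mul]; norm_num; ring
    rw [e]
    have := le_exp_sq z
    have := exp_pos (z ^ 2)
    linarith
  have h₁ := exp_growth hz10
  have h₂ := exp_sub_two_sq_le (z := z) (by linarith)
  have h₃ := mul_le_mul_of_nonneg_left v_le (by linarith : 0 ≤ z)
  have h₄ : 0 ≤ y * v := mul_nonneg (by linarith) (by linarith)
  have e : borellVol y = 2 * borellVol z - v := by linarith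
  rw [e] at large_ge
  linarith

/-- If the triple interval in equilibrium ties with the double interval, the second volume
exceeds the first one by a factor of order at least its half-width. -/
theorem le_of_tie {x u z y m p q r : ℝ} (hx : 0 ≤ x) (hxy : x ≤ y)
    (hu : borellVol x = 2 * borellVol u) (hm : borellVol m = 2 * borellVol z)
    (hz : borellVol m = borellVol x + borellVol y) (hpq : borellVol q - borellVol p = borellVol x)
    (hqr : borellVol r - borellVol q = borellVol y) (hsum : p + q + r = 0)
    (htie : 2 * (exp (u ^ 2) + exp (z ^ 2)) = exp (p ^ 2) + exp (q ^ 2) + exp (r ^ 2)) :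
    borellVol x * (x - 2) ≤ borellVol y := by
  have hVx := nonneg hx
  have hVy := nonneg (hx.trans hxy)
  have tp := tangent_le p (-x)
  have tq := tangent_le q 0
  have tr := tangent_le r y
  rw [map_neg, neg_sq] at tp
  rw [map_zero, zero_pow two_ne_zero, exp_zero] at tq
  have triple_le : exp (p ^ 2) + exp (q ^ 2) + exp (r ^ 2) ≤
      exp (x ^ 2) + 1 + exp (y ^ 2) := by
    have e₁ : borellVol x = borellVol q - borellVol p := by linarith
    have e₂ : borellVol y = borellVol r - borellVol q := by linarith
    have e₃ : r = -p - q := by linarith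
    rw [e₁] at tp
    rw [e₂] at tr
    have e₄ : 2 * r * (borellVol r - borellVol q - borellVol r) = 2 * (p + q) * borellVol q := by
      rw [e₃]; ring
    rw [e₄] at tr
    linarith
  have hu0 : 0 ≤ u := strictMono.le_iff_le.1 (by rw [map_zero]; linarith)
  have hz0 : 0 ≤ z := strictMono.le_iff_le.1 (by rw [map_zero]; linarith)
  have h₁ := exp_sq_le_two_mul_exp_sq hu0 hu
  have h₂ := exp_sq_le_two_mul_exp_sq hz0 hm
  have h₃ := tangent_le y m
  have h₄ := mul_le_mul_of_nonneg_right hxy hVx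
  rw [hz] at h₃
  linarith

theorem hasDerivAt_density {X : ℝ → ℝ} (hX : ∀ v, borellVol (X v) = v) (v : ℝ) :
    HasDerivAt (fun v => exp (X v ^ 2)) (2 * X v) v := by
  have hmono : StrictMono X := fun a b hab => strictMono.lt_iff_lt.1 (by rwa [hX, hX])
  have hsurj : Function.Surjective X := fun x => ⟨borellVol x, strictMono.injective (hX _)⟩
  have hXd : HasDerivAt X (exp (X v ^ 2))⁻¹ v :=
    (hasDerivAt (X v)).of_local_left_inverse
      (hmono.monotone.continuous_of_surjective hsurj).continuousAt (exp_ne_zero _)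
      (Eventually.of_forall hX)
  exact ((hasDerivAt_exp_sq (X v)).comp v hXd).congr_deriv (by field_simp)

end borellVol

theorem eventually_rpow_add_le {a b : ℝ} (hab : a < b) (hb : 0 < b) (C : ℝ) :
    ∀ᶠ y : ℝ in atTop, y ^ a + C ≤ y ^ b := by
  filter_upwards [eventually_gt_atTop 0,
    (tendsto_rpow_atTop (sub_pos.2 hab)).eventually_ge_atTop 2,
    (tendsto_rpow_atTop hb).eventually_ge_atTop (2 * C)] with y hy h₁ h₂
  have h₃ : 2 * y ^ a ≤ y ^ b := by
    calc 2 * y ^ a ≤ y ^ (b - a) * y ^ a := by gcongr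
      _ = y ^ b := by rw [← Real.rpow_add hy, sub_add_cancel]
  linarith

/-- Bounds on the tie function for the Borell density `f(x) = e^{x²}`: with `g` the
density in volume coordinates and `lam` the tie function, for every `ε > 0` and all
sufficiently large `V₁`, `V₁ (log V₁)^{1/2-ε} ≤ lam V₁ ≤ V₁^{4+ε}`. -/
theorem borell_tie_bounds
    (f : ℝ → ℝ) (hf : ∀ x, f x = Real.exp (x ^ 2))
    (V : ℝ → ℝ) (hV : ∀ x, V x = ∫ t in (0:ℝ)..x, f t)
    (xOf : ℝ → ℝ) (hleft : ∀ x, xOf (V x) = x) (hright : ∀ v, V (xOf v) = v)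
    (g : ℝ → ℝ) (hg : ∀ v, g v = f (xOf v))
    (Vt : ℝ → ℝ → ℝ)
    (hVt : ∀ V₁ V₂, 0 < V₁ → V₁ ≤ V₂ →
      deriv g (Vt V₁ V₂) + deriv g (Vt V₁ V₂ + V₁) + deriv g (Vt V₁ V₂ + V₁ + V₂) = 0)
    (μ : ℝ → ℝ → ℝ)
    (hμ : ∀ V₁ V₂, μ V₁ V₂ = 2 * (g (V₁ / 2) + g ((V₁ + V₂) / 2)) -
      (g (Vt V₁ V₂) + g (Vt V₁ V₂ + V₁) + g (Vt V₁ V₂ + V₁ + V₂)))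
    (lam : ℝ → ℝ) (hlam : ∀ V₁ > 0, V₁ < lam V₁ ∧ μ V₁ (lam V₁) = 0) :
    ∀ ε > 0, ∀ᶠ V₁ in atTop,
      V₁ * (Real.log V₁) ^ ((1:ℝ) / 2 - ε) ≤ lam V₁ ∧
        lam V₁ ≤ V₁ ^ ((4:ℝ) + ε) := by
  obtain rfl : V = borellVol := funext fun x => by
    rw [hV, borellVol]
    simp only [hf]
  obtain rfl : g = fun v => Real.exp (xOf v ^ 2) := funext fun v => by rw [hg, hf]
  simp only [(borellVol.hasDerivAt_density hright _).deriv] at hVt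
  have hmono : ∀ {a b : ℝ}, a ≤ b → xOf a ≤ xOf b := fun hab =>
    borellVol.strictMono.le_iff_le.1 (by rwa [hright, hright])
  intro ε hε
  have hpow : ∀ᶠ v : ℝ in atTop, Real.log v ^ ((1:ℝ) / 2 - ε) + 2 ≤ Real.log v ^ ((1:ℝ) / 2) :=
    Real.tendsto_log_atTop.eventually
      (eventually_rpow_add_le (by linarith) (by norm_num) 2)
  filter_upwards [hpow, eventually_ge_atTop 1, eventually_ge_atTop (borellVol 10)]
    with v hv hv1 hv10
  have hv0 : 0 < v := by linarith
  obtain ⟨hlt, htie⟩ := hlam v hv0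
  have hsum := hVt v (lam v) hv0 hlt.le
  rw [hμ, sub_eq_zero] at htie
  constructor
  · have hx : 0 ≤ xOf v := by
      rw [← hleft 0, borellVol.map_zero]
      exact hmono hv0.le
    have key := borellVol.le_of_tie (x := xOf v) (u := xOf (v / 2)) (z := xOf ((v + lam v) / 2))
      (y := xOf (lam v)) (m := xOf (v + lam v)) hx (hmono hlt.le)
      (by simp only [hright]; ring) (by simp only [hright]; ring) (by simp only [hright])
      (by simp only [hright]; ring) (by simp only [hright]; ring) (by linarith) htie
    rw [hright, hright] at key
    refine le_trans ?_ key
    have hlog : Real.log v ^ ((1:ℝ) / 2) ≤ xOf v := by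
      rw [← Real.sqrt_eq_rpow]
      refine Real.sqrt_le_iff.2 ⟨hx, (Real.log_le_iff_le_exp hv0).2 ?_⟩
      simpa only [hright] using borellVol.le_exp_sq (xOf v)
    gcongr
    linarith
  · by_contra! hgt
    have h4 : v ^ 4 ≤ lam v := by
      refine le_trans ?_ hgt.le
      rw [← Real.rpow_natCast]
      exact Real.rpow_le_rpow_of_exponent_le hv1 (by norm_num; linarith)
    refine (borellVol.double_lt_triple hv1 (z := xOf ((v + lam v) / 2)) (y := xOf (lam v))
      ?_ ?_ ?_ ?_ ?_ ?_).ne htie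
    · rw [hright]; ring
    · rw [hright, hright]; ring
    · rw [hright, hright]; ring
    · rw [hright, hright, hright]; ring
    · rwa [hright]
    · rw [← hleft 10]
      exact hmono (by linarith)
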